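/- Let T > 0 and let V satisfy (H1) 0 ≤ V(μ)(x) ≤ V_max, (H2) |V(μ)(x) − V(μ)(y)| ≤ L |x − y|, (H3) |V(μ₁)(x) − V(μ₂)(x)| ≤ L ‖μ₁ − μ₂‖*_BL. Let μ₀ be a finite nonnegative Borel measure on ℝ with finite first and second moments. Then the measure-valued solution of the nonlinear transport equation ∂_t m + ∂_x(V(m_t) m) = 0 on [0,T] with initial datum μ₀ is unique: if (m¹_t) and (m²_t) are two measure-valued solutions with the same initial datum μ₀, then m¹_t = m²_t for every t ∈ [0,T]. -/

import Mathlib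

open MeasureTheory Set

/-- The bounded-Lipschitz norm of a function: sup of |φ| plus the least Lipschitz constant. -/
noncomputable def blNorm {X : Type*} [PseudoMetricSpace X] (φ : X → ℝ) : ℝ :=
  (⨆ x, |φ x|) + sInf {K : ℝ | 0 ≤ K ∧ LipschitzWith K.toNNReal φ}

/-- A function is bounded Lipschitz. -/
def IsBoundedLipschitz {X : Type*} [PseudoMetricSpace X] (φ : X → ℝ) : Prop :=
  (∃ C, ∀ x, |φ x| ≤ C) ∧ ∃ K, LipschitzWith K φ

/-- The bounded-Lipschitz (flat) dual distance between two measures: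
`‖μ − ν‖*_BL = sup {|∫ φ dμ − ∫ φ dν| : φ bounded Lipschitz, ‖φ‖_BL ≤ 1}`. -/
noncomputable def blDist {X : Type*} [PseudoMetricSpace X] [MeasurableSpace X]
    (μ ν : Measure X) : ℝ :=
  sSup {r : ℝ | ∃ φ : X → ℝ, IsBoundedLipschitz φ ∧ blNorm φ ≤ 1 ∧
    r = |(∫ x, φ x ∂μ) - ∫ x, φ x ∂ν|}

/-- A measure-valued solution of the nonlinear transport equation
`∂ₜ m + ∂ₓ(V(m_t) m) = 0` on `[0,T]` with initial datum `μ₀`: a family of finite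
nonnegative Borel measures, continuous in time for the bounded-Lipschitz distance,
starting at `μ₀` and satisfying the weak formulation against all compactly supported
`C¹` test functions. -/
def IsMVSolution (T : ℝ) (V : Measure ℝ → ℝ → ℝ) (μ₀ : Measure ℝ)
    (m : ℝ → Measure ℝ) : Prop :=
  (∀ t ∈ Set.Icc (0:ℝ) T, IsFiniteMeasure (m t)) ∧
  (∀ t ∈ Set.Icc (0:ℝ) T, ∀ ε > (0:ℝ), ∃ δ > (0:ℝ), ∀ s ∈ Set.Icc (0:ℝ) T,
    |s - t| < δ → blDist (m s) (m t) < ε) ∧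
  m 0 = μ₀ ∧
  (∀ f : ℝ × ℝ → ℝ, ContDiff ℝ 1 f → HasCompactSupport f →
    (∫ x, f (x, T) ∂(m T)) - (∫ x, f (x, 0) ∂μ₀) =
      ∫ t in (0:ℝ)..T, ∫ x,
        (fderiv ℝ f (x, t) (0, 1) + V (m t) x * fderiv ℝ f (x, t) (1, 0)) ∂(m t))

open Filter Topology

section BoundedLipschitzDistance

variable {X : Type*} [PseudoMetricSpace X]

theorem IsBoundedLipschitz.abs_le_blNorm {φ : X → ℝ} (hφ : IsBoundedLipschitz φ) (x : X) :
    |φ x| ≤ blNorm φ := by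
  obtain ⟨⟨C, hC⟩, -⟩ := hφ
  have h1 : |φ x| ≤ ⨆ x, |φ x| := le_ciSup ⟨C, by rintro _ ⟨y, rfl⟩; exact hC y⟩ x
  have h2 : 0 ≤ sInf {K : ℝ | 0 ≤ K ∧ LipschitzWith K.toNNReal φ} :=
    Real.sInf_nonneg fun K hK => hK.1
  unfold blNorm
  linarith

theorem IsBoundedLipschitz.abs_sub_le {φ : X → ℝ} (hφ : IsBoundedLipschitz φ) (x y : X) :
    |φ x - φ y| ≤ blNorm φ * dist x y := by
  obtain ⟨-, K₀, hK₀⟩ := hφ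
  have h0 : 0 ≤ ⨆ x, |φ x| := Real.iSup_nonneg fun x => abs_nonneg _
  have key : ∀ K ∈ {K : ℝ | 0 ≤ K ∧ LipschitzWith K.toNNReal φ}, |φ x - φ y| ≤ K * dist x y := by
    rintro K ⟨hK, hL⟩
    simpa [Real.dist_eq, hK] using hL.dist_le_mul x y
  have hne : {K : ℝ | 0 ≤ K ∧ LipschitzWith K.toNNReal φ}.Nonempty :=
    ⟨K₀, K₀.2, by simpa using hK₀⟩
  rcases (dist_nonneg : 0 ≤ dist x y).eq_or_lt with h | h
  · simpa [← h] using key K₀ ⟨K₀.2, by simpa using hK₀⟩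
  · have : |φ x - φ y| / dist x y ≤ sInf {K : ℝ | 0 ≤ K ∧ LipschitzWith K.toNNReal φ} :=
      le_csInf hne fun K hK => (div_le_iff₀ h).2 (key K hK)
    rw [← div_le_iff₀ h]
    unfold blNorm
    linarith

theorem blNorm_le {φ : X → ℝ} {C : ℝ} {K : NNReal} (hC₀ : 0 ≤ C) (hC : ∀ x, |φ x| ≤ C)
    (hK : LipschitzWith K φ) : blNorm φ ≤ C + K := by
  refine add_le_add (Real.iSup_le hC hC₀) (csInf_le ⟨0, fun K hK => hK.1⟩ ⟨K.2, ?_⟩)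
  simpa using hK

variable [MeasurableSpace X]

theorem blDist_nonneg (μ ν : Measure X) : 0 ≤ blDist μ ν := by
  refine Real.sSup_nonneg ?_
  rintro _ ⟨φ, -, -, rfl⟩
  exact abs_nonneg _

theorem blDist_le {μ ν : Measure X} {D : ℝ}
    (h : ∀ φ : X → ℝ, IsBoundedLipschitz φ → blNorm φ ≤ 1 →
      |(∫ x, φ x ∂μ) - ∫ x, φ x ∂ν| ≤ D) : blDist μ ν ≤ D := by
  refine csSup_le ⟨_, fun _ => 0, ⟨⟨0, by simp⟩, 0, LipschitzWith.const 0⟩, ?_, rfl⟩ ?_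
  · refine (blNorm_le (φ := fun _ : X => (0 : ℝ)) le_rfl (by simp) (LipschitzWith.const 0)).trans ?_
    simp
  · rintro _ ⟨φ, hφ, h1, rfl⟩
    exact h φ hφ h1

theorem abs_integral_sub_integral_le_measure_univ {μ ν : Measure X} [IsFiniteMeasure μ]
    [IsFiniteMeasure ν] {φ : X → ℝ} (hφ : IsBoundedLipschitz φ) (h1 : blNorm φ ≤ 1) :
    |(∫ x, φ x ∂μ) - ∫ x, φ x ∂ν| ≤ μ.real univ + ν.real univ := by
  have hb : ∀ x, ‖φ x‖ ≤ 1 := fun x => (hφ.abs_le_blNorm x).trans h1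
  have hμ := norm_integral_le_of_norm_le_const (μ := μ) (ae_of_all _ hb)
  have hν := norm_integral_le_of_norm_le_const (μ := ν) (ae_of_all _ hb)
  rw [one_mul, Real.norm_eq_abs] at hμ hν
  exact (abs_sub _ _).trans (add_le_add hμ hν)

theorem blDist_le_measure_univ (μ ν : Measure X) [IsFiniteMeasure μ] [IsFiniteMeasure ν] :
    blDist μ ν ≤ μ.real univ + ν.real univ :=
  blDist_le fun _ hφ h1 => abs_integral_sub_integral_le_measure_univ hφ h1

theorem abs_integral_sub_integral_le_blDist (μ ν : Measure X) [IsFiniteMeasure μ]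
    [IsFiniteMeasure ν] {φ : X → ℝ} {C : ℝ} {K : NNReal} (hC₀ : 0 ≤ C) (hC : ∀ x, |φ x| ≤ C)
    (hK : LipschitzWith K φ) :
    |(∫ x, φ x ∂μ) - ∫ x, φ x ∂ν| ≤ (C + K + 1) * blDist μ ν := by
  have hc : 0 < C + K + 1 := by positivity
  set c := C + K + 1 with hcdef
  have hb : ∀ x, |c⁻¹ * φ x| ≤ c⁻¹ * C := fun x => by
    rw [abs_mul, abs_of_pos (inv_pos.2 hc)]
    gcongr
    exact hC x
  have hl : LipschitzWith (c⁻¹.toNNReal * K) fun x => c⁻¹ * φ x := by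
    refine LipschitzWith.of_dist_le_mul fun x y => ?_
    have := hK.dist_le_mul x y
    rw [Real.dist_eq] at this
    rw [Real.dist_eq, ← mul_sub, abs_mul, abs_of_pos (inv_pos.2 hc), NNReal.coe_mul,
      Real.coe_toNNReal _ (inv_pos.2 hc).le, mul_assoc]
    gcongr
  have hφ : IsBoundedLipschitz fun x => c⁻¹ * φ x := ⟨⟨_, hb⟩, _, hl⟩
  have h1 : blNorm (fun x => c⁻¹ * φ x) ≤ 1 := by
    refine (blNorm_le (by positivity) hb hl).trans ?_
    rw [NNReal.coe_mul, Real.coe_toNNReal _ (inv_pos.2 hc).le, ← mul_add, inv_mul_le_iff₀ hc]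
    linarith
  have h2 : |(∫ x, c⁻¹ * φ x ∂μ) - ∫ x, c⁻¹ * φ x ∂ν| ≤ blDist μ ν :=
    le_csSup ⟨μ.real univ + ν.real univ, by
      rintro _ ⟨ψ, hψ, hψ1, rfl⟩
      exact abs_integral_sub_integral_le_measure_univ hψ hψ1⟩ ⟨_, hφ, h1, rfl⟩
  rwa [integral_const_mul, integral_const_mul, ← mul_sub, abs_mul, abs_of_pos (inv_pos.2 hc),
    inv_mul_le_iff₀ hc] at h2

theorem blDist_map_le [BorelSpace X] {α : Type*} [MeasurableSpace α] (μ : Measure α)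
    [IsFiniteMeasure μ] {f g : α → X} (hf : Measurable f) (hg : Measurable g) {C : ℝ}
    (h : ∀ a, dist (f a) (g a) ≤ C) :
    blDist (μ.map f) (μ.map g) ≤ C * μ.real univ := by
  refine blDist_le fun φ hφ h1 => ?_
  obtain ⟨K, hK⟩ := hφ.2
  have hb : ∀ x, ‖φ x‖ ≤ 1 := fun x => (hφ.abs_le_blNorm x).trans h1
  have hm := hK.continuous.measurable
  have hint : ∀ u : α → X, Measurable u → Integrable (fun a => φ (u a)) μ := fun u hu =>
    Integrable.of_bound (hm.comp hu).aestronglyMeasurable 1 (ae_of_all _ fun a => hb _)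
  rw [integral_map hf.aemeasurable hm.aestronglyMeasurable,
    integral_map hg.aemeasurable hm.aestronglyMeasurable, ← integral_sub (hint f hf) (hint g hg)]
  rw [← Real.norm_eq_abs]
  refine norm_integral_le_of_norm_le_const (μ := μ) (ae_of_all _ fun a => ?_)
  rw [Real.norm_eq_abs]
  calc |φ (f a) - φ (g a)| ≤ blNorm φ * dist (f a) (g a) := hφ.abs_sub_le _ _
    _ ≤ 1 * dist (f a) (g a) := by gcongr
    _ ≤ C := by simpa using h a

end BoundedLipschitzDistance

section Characteristics

/-- A `C¹` curve on the line which is an integral curve of `v` on `[0, T]`. -/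
def IsCharacteristic (T : ℝ) (v : ℝ → ℝ → ℝ) (X : ℝ → ℝ) : Prop :=
  ContDiff ℝ 1 X ∧ ∀ s ∈ Icc 0 T, HasDerivAt X (v s (X s)) s

variable {T L : ℝ} {v : ℝ → ℝ → ℝ}

theorem continuousOn_apply_curve (hL : ∀ s ∈ Icc 0 T, ∀ x y, |v s x - v s y| ≤ L * |x - y|)
    (hc : ∀ x, ContinuousOn (v · x) (Icc 0 T)) {X : ℝ → ℝ} (hX : ContinuousOn X (Icc 0 T)) :
    ContinuousOn (fun s => v s (X s)) (Icc 0 T) := by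
  intro t ht
  have h2 : Tendsto (fun s => L * |X s - X t| + |v s (X t) - v t (X t)|) (𝓝[Icc 0 T] t)
      (𝓝 (L * |X t - X t| + |v t (X t) - v t (X t)|)) :=
    (((hX t ht).sub_const _).abs.const_mul L).add (((hc (X t)) t ht).sub_const _).abs
  simp only [sub_self, abs_zero, mul_zero, add_zero] at h2
  refine tendsto_iff_dist_tendsto_zero.2 (squeeze_zero' (Eventually.of_forall fun _ => dist_nonneg)
    ?_ h2)
  filter_upwards [self_mem_nhdsWithin] with s hs
  rw [Real.dist_eq]
  exact (abs_sub_le _ (v s (X t)) _).trans (add_le_add_left (hL s hs _ _) _)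

theorem ContinuousOn.exists_continuous_eqOn {f : ℝ → ℝ} {a b : ℝ} (hf : ContinuousOn f (Icc a b))
    (hab : a ≤ b) : ∃ g : ℝ → ℝ, Continuous g ∧ EqOn g f (Icc a b) :=
  ⟨_, (continuousOn_iff_continuous_domRestrict.1 hf).Icc_extend' (h := hab), fun s hs => by
    rw [IccExtend_of_mem hab _ hs, domRestrict_apply]⟩

theorem exists_isCharacteristic {M : ℝ} (hT : 0 ≤ T) (hM : ∀ s ∈ Icc 0 T, ∀ x, |v s x| ≤ M)
    (hL : ∀ s ∈ Icc 0 T, ∀ x y, |v s x - v s y| ≤ L * |x - y|)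
    (hc : ∀ x, ContinuousOn (v · x) (Icc 0 T)) {t : ℝ} (ht : t ∈ Icc 0 T) (y : ℝ) :
    ∃ X, IsCharacteristic T v X ∧ X t = y := by
  have hM0 : 0 ≤ M := (abs_nonneg _).trans (hM t ht 0)
  have hL0 : 0 ≤ L := by simpa using (abs_nonneg _).trans (hL t ht 1 0)
  have hP : IsPicardLindelof v (⟨t, ht⟩ : Icc 0 T) y (M * T).toNNReal 0 M.toNNReal L.toNNReal :=
    { lipschitzOnWith := fun s hs => (LipschitzWith.of_dist_le_mul fun x z => by
        simpa [Real.dist_eq, hL0] using hL s hs x z).lipschitzOnWith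
      continuousOn := fun x _ => hc x
      norm_le := fun s hs x _ => by simpa [hM0] using hM s hs x
      mul_max_le := by
        rw [Real.coe_toNNReal _ hM0, Real.coe_toNNReal _ (by positivity)]
        simp only [NNReal.coe_zero, sub_zero]
        gcongr
        exact max_le (by linarith [ht.1]) ht.2 }
  obtain ⟨Z, hZt, hZ⟩ := hP.exists_eq_forall_mem_Icc_hasDerivWithinAt₀
  have hZc : ContinuousOn Z (Icc 0 T) := fun s hs => (hZ s hs).continuousWithinAt
  have hw := continuousOn_apply_curve hL hc hZc
  obtain ⟨w, hwc, hws⟩ := hw.exists_continuous_eqOn hT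
  have hd : ∀ s, HasDerivAt (fun s => y + ∫ r in t..s, w r) (w s) s := fun s =>
    (intervalIntegral.integral_hasDerivAt_right (hwc.intervalIntegrable _ _)
      (hwc.stronglyMeasurableAtFilter _ _) hwc.continuousAt).const_add y
  have heq : ∀ s ∈ Icc 0 T, y + ∫ r in t..s, w r = Z s := by
    intro s hs
    have hsub : uIcc t s ⊆ Icc 0 T := uIcc_subset_Icc ht hs
    rw [intervalIntegral.integral_congr fun r hr => hws (hsub hr),
      intervalIntegral.integral_eq_sub_of_hasDeriv_right (hZc.mono hsub) ?_
        ((hw.mono hsub).intervalIntegrable), hZt]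
    · ring
    · intro r hr
      have hr' : r ∈ Ioo 0 T :=
        ⟨(le_min ht.1 hs.1).trans_lt hr.1, hr.2.trans_le (max_le ht.2 hs.2)⟩
      exact ((hZ r (Ioo_subset_Icc_self hr')).hasDerivAt (Icc_mem_nhds hr'.1 hr'.2)).hasDerivWithinAt
  refine ⟨fun s => y + ∫ r in t..s, w r, ⟨?_, fun s hs => ?_⟩, by simp⟩
  · refine contDiff_one_iff_deriv.2 ⟨fun s => (hd s).differentiableAt, ?_⟩
    rwa [show deriv (fun s => y + ∫ r in t..s, w r) = w from funext fun s => (hd s).deriv]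
  · have h := hd s
    rw [hws hs] at h
    simpa only [heq s hs] using h

theorem IsCharacteristic.eqOn {X Y : ℝ → ℝ} (hX : IsCharacteristic T v X)
    (hY : IsCharacteristic T v Y)
    (hL : ∀ s ∈ Icc 0 T, ∀ x y, |v s x - v s y| ≤ L * |x - y|) {t : ℝ} (ht : t ∈ Icc 0 T)
    (h : X t = Y t) : EqOn X Y (Icc 0 T) := by
  have hL0 : 0 ≤ L := by simpa using (abs_nonneg _).trans (hL t ht 1 0)
  have hLip : ∀ s ∈ Icc 0 T, LipschitzOnWith L.toNNReal (v s) univ := fun s hs =>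
    (LipschitzWith.of_dist_le_mul fun x z => by
      simpa [Real.dist_eq, hL0] using hL s hs x z).lipschitzOnWith
  intro s hs
  rcases le_total t s with hts | hts
  · exact ODE_solution_unique_of_mem_Icc_right (v := v) (s := fun _ => univ) (a := t) (b := T)
      (fun r hr => hLip r ⟨ht.1.trans hr.1, hr.2.le⟩)
      hX.1.continuous.continuousOn
      (fun r hr => (hX.2 r ⟨ht.1.trans hr.1, hr.2.le⟩).hasDerivWithinAt) (fun _ _ => trivial)
      hY.1.continuous.continuousOn
      (fun r hr => (hY.2 r ⟨ht.1.trans hr.1, hr.2.le⟩).hasDerivWithinAt) (fun _ _ => trivial)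
      h ⟨hts, hs.2⟩
  · exact ODE_solution_unique_of_mem_Icc_left (v := v) (s := fun _ => univ) (a := 0) (b := t)
      (fun r hr => hLip r ⟨hr.1.le, hr.2.trans ht.2⟩)
      hX.1.continuous.continuousOn
      (fun r hr => (hX.2 r ⟨hr.1.le, hr.2.trans ht.2⟩).hasDerivWithinAt) (fun _ _ => trivial)
      hY.1.continuous.continuousOn
      (fun r hr => (hY.2 r ⟨hr.1.le, hr.2.trans ht.2⟩).hasDerivWithinAt) (fun _ _ => trivial)
      h ⟨hs.1, hts⟩

theorem IsCharacteristic.le_of_le {X Y : ℝ → ℝ} (hX : IsCharacteristic T v X)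
    (hY : IsCharacteristic T v Y)
    (hL : ∀ s ∈ Icc 0 T, ∀ x y, |v s x - v s y| ≤ L * |x - y|) {s t : ℝ} (hs : s ∈ Icc 0 T)
    (ht : t ∈ Icc 0 T) (h : X s ≤ Y s) : X t ≤ Y t := by
  by_contra! hlt
  have hc : ContinuousOn (fun r => Y r - X r) (uIcc s t) :=
    (hY.1.continuous.sub hX.1.continuous).continuousOn
  have h0 : (0 : ℝ) ∈ uIcc (Y s - X s) (Y t - X t) :=
    mem_uIcc.2 (Or.inr ⟨by linarith, by linarith⟩)
  obtain ⟨r, hr, hr0⟩ := intermediate_value_uIcc hc h0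
  have := hX.eqOn hY hL (uIcc_subset_Icc hs ht hr) (by linarith [show Y r - X r = 0 from hr0]) ht
  linarith

theorem IsCharacteristic.le_iff_le {X Y : ℝ → ℝ} (hX : IsCharacteristic T v X)
    (hY : IsCharacteristic T v Y)
    (hL : ∀ s ∈ Icc 0 T, ∀ x y, |v s x - v s y| ≤ L * |x - y|) {s t : ℝ} (hs : s ∈ Icc 0 T)
    (ht : t ∈ Icc 0 T) : X s ≤ Y s ↔ X t ≤ Y t :=
  ⟨hX.le_of_le hY hL hs ht, hX.le_of_le hY hL ht hs⟩

/-- Comparison of integral curves of two velocity fields whose distance grows at most like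
`K * exp (c * t)`. -/
theorem IsCharacteristic.abs_sub_le_exp {w : ℝ → ℝ → ℝ} {X Y : ℝ → ℝ}
    (hX : IsCharacteristic T v X) (hY : IsCharacteristic T w Y)
    (hL : ∀ s ∈ Icc 0 T, ∀ x y, |v s x - v s y| ≤ L * |x - y|) {K C c : ℝ} (hC : 0 ≤ C)
    (hvw : ∀ s ∈ Icc 0 T, ∀ x, |v s x - w s x| ≤ K * Real.exp (c * s)) (hKC : L * C + K < c * C)
    (h0 : X 0 = Y 0) : ∀ t ∈ Icc 0 T, |X t - Y t| ≤ C * Real.exp (c * t) := by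
  have hexp : ∀ s : ℝ, HasDerivAt (fun s => C * Real.exp (c * s)) (C * (Real.exp (c * s) * c)) s :=
    fun s => by simpa using (((hasDerivAt_id s).const_mul c).exp).const_mul C
  refine image_norm_le_of_norm_deriv_right_lt_deriv_boundary' (f := fun s => X s - Y s)
    (f' := fun s => v s (X s) - w s (Y s)) (B := fun s => C * Real.exp (c * s))
    (hX.1.continuous.sub hY.1.continuous).continuousOn
    (fun s hs => ((hX.2 s (Ico_subset_Icc_self hs)).sub
      (hY.2 s (Ico_subset_Icc_self hs))).hasDerivWithinAt) (by simpa [h0] using hC)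
    (fun s _ => (hexp s).continuousAt.continuousWithinAt)
    (fun s _ => (hexp s).hasDerivWithinAt) ?_
  intro s hs heq
  have hs' := Ico_subset_Icc_self hs
  rw [Real.norm_eq_abs] at heq ⊢
  have h1 := abs_sub_le (v s (X s)) (v s (Y s)) (w s (Y s))
  have h2 := hL s hs' (X s) (Y s)
  have h3 := hvw s hs' (Y s)
  rw [heq] at h2
  nlinarith [Real.exp_pos (c * s), mul_lt_mul_of_pos_right hKC (Real.exp_pos (c * s))]

end Characteristics

section TimeDependentMeasures

variable {T : ℝ} {m : ℝ → Measure ℝ}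

theorem tendsto_integral_of_lipschitz (hfin : ∀ t ∈ Icc 0 T, IsFiniteMeasure (m t))
    (hcont : ∀ t ∈ Icc 0 T, Tendsto (fun s => blDist (m s) (m t)) (𝓝[Icc 0 T] t) (𝓝 0))
    {φ : ℝ → ℝ} {C : ℝ} {K : NNReal} (hC₀ : 0 ≤ C) (hC : ∀ x, |φ x| ≤ C)
    (hK : LipschitzWith K φ) {t : ℝ} (ht : t ∈ Icc 0 T) :
    Tendsto (fun s => ∫ x, φ x ∂(m s)) (𝓝[Icc 0 T] t) (𝓝 (∫ x, φ x ∂(m t))) := by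
  have h := (hcont t ht).const_mul (C + K + 1)
  rw [mul_zero] at h
  refine tendsto_iff_dist_tendsto_zero.2 (squeeze_zero' (Eventually.of_forall fun _ => dist_nonneg)
    ?_ h)
  filter_upwards [self_mem_nhdsWithin] with s hs
  have := hfin s hs
  have := hfin t ht
  exact abs_integral_sub_integral_le_blDist _ _ hC₀ hC hK

theorem tendsto_measureReal_univ (hfin : ∀ t ∈ Icc 0 T, IsFiniteMeasure (m t))
    (hcont : ∀ t ∈ Icc 0 T, Tendsto (fun s => blDist (m s) (m t)) (𝓝[Icc 0 T] t) (𝓝 0))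
    {t : ℝ} (ht : t ∈ Icc 0 T) :
    Tendsto (fun s => (m s).real univ) (𝓝[Icc 0 T] t) (𝓝 ((m t).real univ)) := by
  simpa using tendsto_integral_of_lipschitz hfin hcont zero_le_one (φ := fun _ => 1) (by simp)
    (LipschitzWith.const 1) ht

theorem exists_measureReal_univ_le (hfin : ∀ t ∈ Icc 0 T, IsFiniteMeasure (m t))
    (hcont : ∀ t ∈ Icc 0 T, Tendsto (fun s => blDist (m s) (m t)) (𝓝[Icc 0 T] t) (𝓝 0)) :
    ∃ M, ∀ t ∈ Icc 0 T, (m t).real univ ≤ M := by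
  obtain ⟨M, hM⟩ := isCompact_Icc.exists_bound_of_continuousOn
    (f := fun t => (m t).real univ) fun t ht => tendsto_measureReal_univ hfin hcont ht
  exact ⟨M, fun t ht => (le_abs_self _).trans (hM t ht)⟩

theorem continuousOn_integral_of_tendstoUniformly (hfin : ∀ t ∈ Icc 0 T, IsFiniteMeasure (m t))
    (hcont : ∀ t ∈ Icc 0 T, Tendsto (fun s => blDist (m s) (m t)) (𝓝[Icc 0 T] t) (𝓝 0))
    {k : ℝ → ℝ → ℝ} (hkc : ∀ t ∈ Icc 0 T, Continuous (k t))
    (hks : ∀ t ∈ Icc 0 T, HasCompactSupport (k t))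
    (hku : ∀ t ∈ Icc 0 T, TendstoUniformly k (k t) (𝓝[Icc 0 T] t)) :
    ContinuousOn (fun t => ∫ x, k t x ∂(m t)) (Icc 0 T) := by
  intro t ht
  refine Metric.tendsto_nhds.2 fun ε hε => ?_
  have := hfin t ht
  set R := (m t).real univ with hR
  have hR0 : 0 ≤ R := measureReal_nonneg
  set δ := ε / (4 * (R + 1)) with hδ
  have hδ0 : 0 < δ := by positivity
  obtain ⟨g, hg, hgk, hgs⟩ := (hkc t ht).exists_contDiff_approx ⊤ (ε := fun _ => δ)
    continuous_const (fun _ => hδ0)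
  have hgc : HasCompactSupport g := (hks t ht).mono hgs
  obtain ⟨K, hK⟩ := hg.lipschitzWith_of_hasCompactSupport hgc (by simp)
  obtain ⟨C, hC⟩ := hgc.exists_bound_of_continuous hg.continuous
  have hlim := tendsto_integral_of_lipschitz hfin hcont ((norm_nonneg _).trans (hC 0)) hC hK ht
  filter_upwards [self_mem_nhdsWithin, Metric.tendsto_nhds.1 hlim (ε / 4) (by positivity),
    (tendsto_measureReal_univ hfin hcont ht).eventually_lt_const (lt_add_one R),
    Metric.tendstoUniformly_iff.1 (hku t ht) δ hδ0] with s hs h1 h2 h3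
  have := hfin s hs
  have int : ∀ r ∈ Icc 0 T, ∀ ν : Measure ℝ, IsFiniteMeasure ν → Integrable (k r) ν :=
    fun r hr ν _ => (hkc r hr).integrable_of_hasCompactSupport (hks r hr)
  have intg : ∀ ν : Measure ℝ, IsFiniteMeasure ν → Integrable g ν :=
    fun ν _ => hg.continuous.integrable_of_hasCompactSupport hgc
  have e1 : |(∫ x, k s x ∂(m s)) - ∫ x, g x ∂(m s)| ≤ 2 * δ * (m s).real univ := by
    rw [← integral_sub (int s hs _ ‹_›) (intg _ ‹_›)]
    rw [← Real.norm_eq_abs]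
    refine norm_integral_le_of_norm_le_const (μ := m s) (ae_of_all _ fun x => ?_)
    have a1 := h3 x
    have a2 := hgk x
    rw [dist_comm] at a1 a2
    rw [← dist_eq_norm]
    linarith [dist_triangle (k s x) (k t x) (g x)]
  have e2 : |(∫ x, g x ∂(m t)) - ∫ x, k t x ∂(m t)| ≤ δ * R := by
    rw [← integral_sub (intg _ ‹_›) (int t ht _ ‹_›)]
    rw [← Real.norm_eq_abs]
    exact norm_integral_le_of_norm_le_const (μ := m t) (ae_of_all _ fun x => by
      rw [← dist_eq_norm]
      exact (hgk x).le)
  rw [Real.dist_eq] at h1 ⊢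
  have e3 : δ * (R + 1) = ε / 4 := by rw [hδ]; field_simp
  have e4 : δ * (m s).real univ < δ * (R + 1) := by gcongr
  have e5 := abs_sub_le (∫ x, k s x ∂(m s)) (∫ x, g x ∂(m s)) (∫ x, k t x ∂(m t))
  have e6 := abs_sub_le (∫ x, g x ∂(m s)) (∫ x, g x ∂(m t)) (∫ x, k t x ∂(m t))
  nlinarith

theorem tendstoUniformly_slice {p : ℝ × ℝ → ℝ} (hp : Continuous p) (hps : HasCompactSupport p)
    (u : Set ℝ) (t : ℝ) :
    TendstoUniformly (fun s x => p (x, s)) (fun x => p (x, t)) (𝓝[u] t) := by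
  have h : UniformContinuous₂ fun s x => p (x, s) :=
    (hps.uniformContinuous_of_continuous hp).comp uniformContinuous_swap
  exact fun w hw => nhdsWithin_le_nhds (h.tendstoUniformly w hw)

theorem HasCompactSupport.slice {p : ℝ × ℝ → ℝ} (hps : HasCompactSupport p) (t : ℝ) :
    HasCompactSupport fun x => p (x, t) :=
  HasCompactSupport.intro (hps.isCompact.image continuous_fst) fun _ hx =>
    image_eq_zero_of_notMem_tsupport fun h => hx ⟨_, h, rfl⟩

variable {v : ℝ → ℝ → ℝ} {M : ℝ}

theorem continuousOn_integral_transport (hfin : ∀ t ∈ Icc 0 T, IsFiniteMeasure (m t))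
    (hcont : ∀ t ∈ Icc 0 T, Tendsto (fun s => blDist (m s) (m t)) (𝓝[Icc 0 T] t) (𝓝 0))
    (hM : ∀ t ∈ Icc 0 T, ∀ x, |v t x| ≤ M) (hvc : ∀ t ∈ Icc 0 T, Continuous (v t))
    (hvu : ∀ t ∈ Icc 0 T, TendstoUniformly v (v t) (𝓝[Icc 0 T] t))
    {f : ℝ × ℝ → ℝ} (hf : ContDiff ℝ 1 f) (hfs : HasCompactSupport f) :
    ContinuousOn (fun t => ∫ x, (fderiv ℝ f (x, t) (0, 1) + v t x * fderiv ℝ f (x, t) (1, 0))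
      ∂(m t)) (Icc 0 T) := by
  have hc : ∀ w, Continuous fun p => fderiv ℝ f p w := fun w =>
    (hf.continuous_fderiv one_ne_zero).clm_apply continuous_const
  have hs : ∀ w, HasCompactSupport fun p => fderiv ℝ f p w := fun w => hfs.fderiv_apply ℝ w
  refine continuousOn_integral_of_tendstoUniformly hfin hcont (fun t ht => ?_) (fun t ht => ?_)
    fun t ht => ?_
  · have := hvc t ht
    have h0 := hc (0, 1)
    have h1 := hc (1, 0)
    fun_prop
  · exact ((hs (0, 1)).slice t).add ((hs (1, 0)).slice t).mul_left
  · obtain ⟨C, hC⟩ := (hs (1, 0)).exists_bound_of_continuous (hc (1, 0))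
    have hM0 : 0 ≤ M := (abs_nonneg _).trans (hM t ht 0)
    have hC0 : 0 ≤ C := (norm_nonneg _).trans (hC 0)
    refine Metric.tendstoUniformly_iff.2 fun ε hε => ?_
    set δ := ε / (1 + M + C) with hδ
    have hδ0 : 0 < δ := by positivity
    filter_upwards [self_mem_nhdsWithin, Metric.tendstoUniformly_iff.1 (hvu t ht) δ hδ0,
      Metric.tendstoUniformly_iff.1
        (tendstoUniformly_slice (hc (0, 1)) (hs (0, 1)) _ t) δ hδ0,
      Metric.tendstoUniformly_iff.1
        (tendstoUniformly_slice (hc (1, 0)) (hs (1, 0)) _ t) δ hδ0]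
      with s hs' h1 h2 h3 x
    specialize h1 x
    specialize h2 x
    specialize h3 x
    rw [Real.dist_eq] at h1 h2 h3 ⊢
    have h4 := hM s hs' x
    have h5 : |fderiv ℝ f (x, t) (1, 0)| ≤ C := hC (x, t)
    have e : δ * (1 + M + C) = ε := by rw [hδ]; field_simp
    generalize fderiv ℝ f (x, t) (0, 1) = a at *
    generalize fderiv ℝ f (x, s) (0, 1) = a' at *
    generalize fderiv ℝ f (x, t) (1, 0) = b at *
    generalize fderiv ℝ f (x, s) (1, 0) = b' at *
    calc |a + v t x * b - (a' + v s x * b')|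
        = |(a - a') + (v t x - v s x) * b + v s x * (b - b')| := by congr 1; ring
      _ ≤ |a - a'| + |v t x - v s x| * |b| + |v s x| * |b - b'| := by
        rw [← abs_mul, ← abs_mul]; exact abs_add_three _ _ _
      _ < δ + δ * C + M * δ := by
        exact add_lt_add_of_lt_of_le (add_lt_add_of_lt_of_le h2 (by gcongr)) (by gcongr)
      _ = ε := by rw [← e]; ring

/-- A weak formulation which only involves the final time `T` holds at every intermediate time. -/
theorem weak_formulation_of_mem_Icc (hT : 0 < T) (hfin : ∀ t ∈ Icc 0 T, IsFiniteMeasure (m t))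
    (hcont : ∀ t ∈ Icc 0 T, Tendsto (fun s => blDist (m s) (m t)) (𝓝[Icc 0 T] t) (𝓝 0))
    (hM : ∀ t ∈ Icc 0 T, ∀ x, |v t x| ≤ M) (hvc : ∀ t ∈ Icc 0 T, Continuous (v t))
    (hvu : ∀ t ∈ Icc 0 T, TendstoUniformly v (v t) (𝓝[Icc 0 T] t))
    (hw : ∀ f : ℝ × ℝ → ℝ, ContDiff ℝ 1 f → HasCompactSupport f →
      (∫ x, f (x, T) ∂(m T)) - (∫ x, f (x, 0) ∂(m 0)) = ∫ t in (0 : ℝ)..T, ∫ x,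
        (fderiv ℝ f (x, t) (0, 1) + v t x * fderiv ℝ f (x, t) (1, 0)) ∂(m t))
    {f : ℝ × ℝ → ℝ} (hf : ContDiff ℝ 1 f) (hfs : HasCompactSupport f) {t : ℝ}
    (ht : t ∈ Icc 0 T) :
    (∫ x, f (x, t) ∂(m t)) - (∫ x, f (x, 0) ∂(m 0)) = ∫ s in (0 : ℝ)..t, ∫ x,
      (fderiv ℝ f (x, s) (0, 1) + v s x * fderiv ℝ f (x, s) (1, 0)) ∂(m s) := by
  have h0T : (0 : ℝ) ∈ Icc 0 T := ⟨le_rfl, hT.le⟩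
  have hTT : T ∈ Icc 0 T := ⟨hT.le, le_rfl⟩
  obtain ⟨G, hGc, hG⟩ := (continuousOn_integral_of_tendstoUniformly hfin hcont
    (k := fun s x => f (x, s)) (fun s _ => hf.continuous.comp (by fun_prop)) (fun s _ => hfs.slice s)
    (fun s _ => tendstoUniformly_slice hf.continuous hfs _ s)).exists_continuous_eqOn hT.le
  obtain ⟨H, hHc, hH⟩ :=
    (continuousOn_integral_transport hfin hcont hM hvc hvu hf hfs).exists_continuous_eqOn hT.le
  have hprim : ∀ {u : ℝ → ℝ}, Continuous u → ∀ s, HasDerivAt (fun s => ∫ r in (0 : ℝ)..s, u r)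
      (u s) s := fun hu s => intervalIntegral.integral_hasDerivAt_right
    (hu.intervalIntegrable _ _) (hu.stronglyMeasurableAtFilter _ _) hu.continuousAt
  set P := fun s => ∫ r in (0 : ℝ)..s, H r with hPdef
  have hP : ∀ s, HasDerivAt P (H s) s := hprim hHc
  have hPc : Continuous P := continuous_iff_continuousAt.2 fun s => (hP s).continuousAt
  set E := fun s => G s - G 0 - P s with hEdef
  have hEc : Continuous E := by fun_prop
  set θ := fun s => ∫ r in (0 : ℝ)..s, E r with hθdef
  have hθ : ∀ s, HasDerivAt θ (E s) s := hprim hEc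
  have hθc : Continuous θ := continuous_iff_continuousAt.2 fun s => (hθ s).continuousAt
  have hθ1 : ContDiff ℝ 1 θ := contDiff_one_iff_deriv.2 ⟨fun s => (hθ s).differentiableAt, by
    rwa [show deriv θ = E from funext fun s => (hθ s).deriv]⟩
  have hθ0 : θ 0 = 0 := by simp [hθdef]
  have hP0 : P 0 = 0 := by simp [hPdef]
  have int : ∀ s ∈ Icc 0 T, ∀ {g : ℝ → ℝ}, Continuous g → HasCompactSupport g →
      Integrable g (m s) := fun s hs g hg hgs => by
    have := hfin s hs
    exact hg.integrable_of_hasCompactSupport hgs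
  have key : θ T * G T = ∫ s in (0 : ℝ)..T, (E s * G s + θ s * H s) := by
    have h := hw (fun p => θ p.2 * f p) ((hθ1.comp contDiff_snd).mul hf) hfs.mul_left
    simp only [integral_const_mul, hθ0, zero_mul, integral_zero, sub_zero] at h
    rw [hG hTT]
    refine h.trans ?_
    refine intervalIntegral.integral_congr fun s hs => ?_
    rw [uIcc_of_le hT.le] at hs
    have hder : ∀ x, HasFDerivAt (fun p : ℝ × ℝ => θ p.2 * f p)
        (θ s • fderiv ℝ f (x, s) + f (x, s) • (E s • ContinuousLinearMap.snd ℝ ℝ ℝ)) (x, s) := by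
      intro x
      have h1 : HasFDerivAt (fun p : ℝ × ℝ => θ p.2)
          (E s • ContinuousLinearMap.snd ℝ ℝ ℝ) (x, s) :=
        HasDerivAt.comp_hasFDerivAt (h₂ := θ) (f := Prod.snd) (x, s) (hθ s) hasFDerivAt_snd
      exact h1.mul ((hf.differentiable one_ne_zero) (x, s)).hasFDerivAt
    have hc : ∀ w, Continuous fun p => fderiv ℝ f p w := fun w =>
      (hf.continuous_fderiv one_ne_zero).clm_apply continuous_const
    have hc0 := hc (0, 1)
    have hc1 := hc (1, 0)
    have hvs := hvc s hs
    simp only [(hder _).fderiv]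
    rw [hG hs, hH hs, ← integral_const_mul, ← integral_const_mul, ← integral_add]
    · refine integral_congr_ae (ae_of_all _ fun x => ?_)
      simp
      ring
    · exact (int s hs (hf.continuous.comp (by fun_prop)) (hfs.slice s)).const_mul _
    · exact (int s hs (by fun_prop) ((hfs.fderiv_apply ℝ (0, 1)).slice s |>.add
        ((hfs.fderiv_apply ℝ (1, 0)).slice s).mul_left)).const_mul _
  have hET : E T = 0 := by
    have h := hw f hf hfs
    rw [intervalIntegral.integral_congr (g := H) fun s hs => ?_] at h
    · simp only [hEdef, hG hTT, hG h0T]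
      rw [h]
      simp [hPdef]
    · rw [uIcc_of_le hT.le] at hs
      exact (hH hs).symm
  have hparts : θ T * P T = ∫ s in (0 : ℝ)..T, (E s * P s + θ s * H s) := by
    rw [intervalIntegral.integral_eq_sub_of_hasDerivAt (f := fun s => θ s * P s)
      (fun s _ => (hθ s).mul (hP s)) ((by fun_prop : Continuous _).intervalIntegrable _ _), hP0]
    simp
  have hconst : θ T * G 0 = ∫ s in (0 : ℝ)..T, E s * G 0 := by
    rw [intervalIntegral.integral_mul_const]
  have hsq : ∫ s in (0 : ℝ)..T, E s ^ 2 = 0 := by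
    have h : ∫ s in (0 : ℝ)..T, E s ^ 2 = θ T * G T - θ T * P T - θ T * G 0 := by
      rw [key, hparts, hconst, ← intervalIntegral.integral_sub, ← intervalIntegral.integral_sub]
      · refine intervalIntegral.integral_congr fun s _ => ?_
        simp only [hEdef]
        ring
      all_goals exact (by fun_prop : Continuous _).intervalIntegrable _ _
    have h' : G T - G 0 - P T = 0 := hET
    rw [h]
    linear_combination θ T * h'
  have hE : E t = 0 := by
    by_contra hne
    have := intervalIntegral.integral_pos hT (f := fun s => E s ^ 2)
      (by fun_prop) (fun s _ => sq_nonneg _) ⟨t, ht, by positivity⟩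
    linarith
  have hfinal : G t - G 0 = P t := by simpa [hEdef, sub_eq_zero] using hE
  rw [hG ht, hG h0T] at hfinal
  rw [hfinal]
  refine intervalIntegral.integral_congr fun s hs => hH (uIcc_subset_Icc h0T ht hs)

end TimeDependentMeasures

section SmoothTransition

theorem continuous_deriv_smoothTransition : Continuous (deriv Real.smoothTransition) :=
  (Real.smoothTransition.contDiff (n := 1)).continuous_deriv le_rfl

theorem deriv_smoothTransition_of_neg {z : ℝ} (hz : z < 0) : deriv Real.smoothTransition z = 0 := by
  have h : Real.smoothTransition =ᶠ[𝓝 z] fun _ => 0 := by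
    filter_upwards [Iio_mem_nhds hz] with y hy
    exact Real.smoothTransition.zero_of_nonpos (le_of_lt hy)
  rw [h.deriv_eq, deriv_const]

theorem deriv_smoothTransition_of_one_lt {z : ℝ} (hz : 1 < z) :
    deriv Real.smoothTransition z = 0 := by
  have h : Real.smoothTransition =ᶠ[𝓝 z] fun _ => 1 := by
    filter_upwards [Ioi_mem_nhds hz] with y hy
    exact Real.smoothTransition.one_of_one_le (le_of_lt hy)
  rw [h.deriv_eq, deriv_const]

theorem exists_abs_mul_deriv_smoothTransition_le :
    ∃ C, ∀ z, |z * deriv Real.smoothTransition z| ≤ C := by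
  have h : HasCompactSupport fun z => z * deriv Real.smoothTransition z := by
    refine HasCompactSupport.intro (isCompact_Icc (a := 0) (b := 1)) fun z hz => ?_
    rcases lt_or_ge z 0 with h0 | h0
    · rw [deriv_smoothTransition_of_neg h0, mul_zero]
    · rw [deriv_smoothTransition_of_one_lt (not_le.1 fun h1 => hz ⟨h0, h1⟩), mul_zero]
  exact h.exists_bound_of_continuous (continuous_id.mul continuous_deriv_smoothTransition)

theorem eventually_one_lt_succ_mul {z : ℝ} (hz : 0 < z) :
    ∀ᶠ n : ℕ in atTop, 1 < ((n : ℝ) + 1) * z :=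
  ((tendsto_natCast_atTop_atTop.atTop_add tendsto_const_nhds).atTop_mul_const hz).eventually_gt_atTop 1

theorem eventually_deriv_smoothTransition_eq_zero {z : ℝ} (hz : z ≠ 0) :
    ∀ᶠ n : ℕ in atTop, deriv Real.smoothTransition (((n : ℝ) + 1) * z) = 0 := by
  rcases hz.lt_or_gt with h | h
  · exact Eventually.of_forall fun n =>
      deriv_smoothTransition_of_neg (mul_neg_of_pos_of_neg (by positivity) h)
  · exact (eventually_one_lt_succ_mul h).mono fun n => deriv_smoothTransition_of_one_lt

theorem tendsto_smoothTransition_succ_mul (z : ℝ) :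
    Tendsto (fun n : ℕ => Real.smoothTransition (((n : ℝ) + 1) * z)) atTop
      (𝓝 ((Ioi 0).indicator 1 z)) := by
  rcases le_or_gt z 0 with h | h
  · rw [indicator_of_notMem (by simpa using h)]
    refine tendsto_const_nhds.congr fun n => ?_
    exact (Real.smoothTransition.zero_of_nonpos
      (mul_nonpos_of_nonneg_of_nonpos (by positivity) h)).symm
  · rw [indicator_of_mem (by simpa using h)]
    refine tendsto_const_nhds.congr' ?_
    filter_upwards [eventually_one_lt_succ_mul h] with n hn
    exact (Real.smoothTransition.one_of_one_le hn.le).symm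

end SmoothTransition

section Conservation

variable {T L M : ℝ} {m : ℝ → Measure ℝ} {v : ℝ → ℝ → ℝ}

/-- A smooth approximation of the indicator function of the region between two curves,
cut off outside of a neighbourhood of the time interval. -/
noncomputable def smoothStrip (β : ℝ → ℝ) (X Y : ℝ → ℝ) (n : ℕ) (p : ℝ × ℝ) : ℝ :=
  β p.2 * (Real.smoothTransition ((n + 1) * (p.1 - X p.2)) -
    Real.smoothTransition ((n + 1) * (p.1 - Y p.2)))

theorem contDiff_smoothStrip {β X Y : ℝ → ℝ} (hβ : ContDiff ℝ 1 β) (hX : ContDiff ℝ 1 X)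
    (hY : ContDiff ℝ 1 Y) (n : ℕ) : ContDiff ℝ 1 (smoothStrip β X Y n) := by
  have h : ∀ {Z : ℝ → ℝ}, ContDiff ℝ 1 Z → ContDiff ℝ 1 fun p : ℝ × ℝ =>
      Real.smoothTransition ((n + 1) * (p.1 - Z p.2)) := fun hZ =>
    Real.smoothTransition.contDiff.comp
      (contDiff_const.mul (contDiff_fst.sub (hZ.comp contDiff_snd)))
  exact (hβ.comp contDiff_snd).mul ((h hX).sub (h hY))

theorem hasCompactSupport_smoothStrip {β X Y : ℝ → ℝ} (hβ : HasCompactSupport β)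
    (hX : Continuous X) (hY : Continuous Y) (n : ℕ) :
    HasCompactSupport (smoothStrip β X Y n) := by
  obtain ⟨A, hA⟩ := hβ.isCompact.exists_bound_of_continuousOn hX.continuousOn
  obtain ⟨B, hB⟩ := hβ.isCompact.exists_bound_of_continuousOn hY.continuousOn
  refine HasCompactSupport.intro ((isCompact_Icc (a := -max A B) (b := max A B + 1)).prod
    hβ.isCompact) fun p hp => ?_
  rw [smoothStrip]
  by_cases hs : p.2 ∈ tsupport β
  · have h1 := abs_le.1 ((hA _ hs).trans (le_max_left A B))
    have h2 := abs_le.1 ((hB _ hs).trans (le_max_right A B))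
    have hn : (0 : ℝ) ≤ n := n.cast_nonneg
    rcases lt_or_ge p.1 (-max A B) with h | h
    · rw [Real.smoothTransition.zero_of_nonpos, Real.smoothTransition.zero_of_nonpos, sub_zero,
        mul_zero]
      all_goals exact mul_nonpos_of_nonneg_of_nonpos (by positivity) (by linarith)
    · have h' : max A B + 1 < p.1 := not_le.1 fun h' => hp ⟨⟨h, h'⟩, hs⟩
      rw [Real.smoothTransition.one_of_one_le, Real.smoothTransition.one_of_one_le, sub_self,
        mul_zero]
      all_goals nlinarith
  · rw [image_eq_zero_of_notMem_tsupport hs, zero_mul]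

theorem fderiv_smoothStrip_transport {β X Y : ℝ → ℝ} {s : ℝ} (hβ : β =ᶠ[𝓝 s] fun _ => 1)
    (hX : HasDerivAt X (v s (X s)) s) (hY : HasDerivAt Y (v s (Y s)) s) (n : ℕ) (x : ℝ) :
    fderiv ℝ (smoothStrip β X Y n) (x, s) (0, 1) +
        v s x * fderiv ℝ (smoothStrip β X Y n) (x, s) (1, 0) =
      (n + 1) * deriv Real.smoothTransition ((n + 1) * (x - X s)) * (v s x - v s (X s)) -
        (n + 1) * deriv Real.smoothTransition ((n + 1) * (x - Y s)) * (v s x - v s (Y s)) := by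
  have hd : ∀ {Z : ℝ → ℝ}, HasDerivAt Z (v s (Z s)) s → HasFDerivAt (fun p : ℝ × ℝ =>
      Real.smoothTransition ((n + 1) * (p.1 - Z p.2)))
      (deriv Real.smoothTransition ((n + 1) * (x - Z s)) • (((n : ℝ) + 1) •
        (ContinuousLinearMap.fst ℝ ℝ ℝ - v s (Z s) • ContinuousLinearMap.snd ℝ ℝ ℝ))) (x, s) := by
    intro Z hZ
    have h1 : HasFDerivAt (fun p : ℝ × ℝ => Z p.2)
        (v s (Z s) • ContinuousLinearMap.snd ℝ ℝ ℝ) (x, s) :=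
      HasDerivAt.comp_hasFDerivAt (h₂ := Z) (f := Prod.snd) (x, s) hZ hasFDerivAt_snd
    have h2 : HasFDerivAt (fun p : ℝ × ℝ => ((n : ℝ) + 1) * (p.1 - Z p.2)) _ (x, s) :=
      (hasFDerivAt_fst.sub h1).const_mul ((n : ℝ) + 1)
    exact HasDerivAt.comp_hasFDerivAt (h₂ := Real.smoothTransition)
      (f := fun p : ℝ × ℝ => ((n : ℝ) + 1) * (p.1 - Z p.2)) (x, s)
      ((Real.smoothTransition.contDiff (n := 1)).differentiable one_ne_zero _).hasDerivAt h2
  have he : smoothStrip β X Y n =ᶠ[𝓝 (x, s)] fun p =>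
      Real.smoothTransition ((n + 1) * (p.1 - X p.2)) -
        Real.smoothTransition ((n + 1) * (p.1 - Y p.2)) := by
    filter_upwards [continuous_snd.tendsto (x, s) hβ] with p hp
    rw [smoothStrip, show β p.2 = 1 from hp, one_mul]
  rw [he.fderiv_eq, ((hd hX).fun_sub (hd hY)).fderiv]
  simp
  ring

theorem abs_front_le {u : ℝ → ℝ} {C : ℝ} (hL : 0 ≤ L) (hu : ∀ x y, |u x - u y| ≤ L * |x - y|)
    (hC : ∀ z, |z * deriv Real.smoothTransition z| ≤ C) (n : ℕ) (a x : ℝ) :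
    |(n + 1) * deriv Real.smoothTransition ((n + 1) * (x - a)) * (u x - u a)| ≤ L * C := by
  have hn : (0 : ℝ) < n + 1 := by positivity
  calc |(n + 1) * deriv Real.smoothTransition ((n + 1) * (x - a)) * (u x - u a)|
      = (n + 1) * |deriv Real.smoothTransition ((n + 1) * (x - a))| * |u x - u a| := by
        rw [abs_mul, abs_mul, abs_of_pos hn]
    _ ≤ (n + 1) * |deriv Real.smoothTransition ((n + 1) * (x - a))| * (L * |x - a|) := by
        gcongr
        exact hu x a
    _ = L * |(n + 1) * (x - a) * deriv Real.smoothTransition ((n + 1) * (x - a))| := by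
        rw [abs_mul, abs_mul, abs_of_pos hn]
        ring
    _ ≤ L * C := by
        gcongr
        exact hC _

theorem tendsto_front (u : ℝ → ℝ) (a x : ℝ) :
    Tendsto (fun n : ℕ => ((n : ℝ) + 1) * deriv Real.smoothTransition ((n + 1) * (x - a)) *
      (u x - u a)) atTop (𝓝 0) := by
  refine tendsto_const_nhds.congr' ?_
  rcases eq_or_ne x a with rfl | h
  · simp
  · filter_upwards [eventually_deriv_smoothTransition_eq_zero (sub_ne_zero.2 h)] with n hn
    rw [hn, mul_zero, zero_mul]

theorem tendsto_integral_smoothTransition_sub (μ : Measure ℝ) [IsFiniteMeasure μ] {a b : ℝ}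
    (hab : a ≤ b) :
    Tendsto (fun n : ℕ => ∫ x, (Real.smoothTransition ((n + 1) * (x - a)) -
      Real.smoothTransition ((n + 1) * (x - b))) ∂μ) atTop (𝓝 (μ.real (Ioc a b))) := by
  rw [← integral_indicator_one measurableSet_Ioc]
  have hS := Real.smoothTransition.continuous
  refine tendsto_integral_of_dominated_convergence (fun _ => 1)
    (fun n => (by fun_prop : Continuous _).aestronglyMeasurable) (integrable_const _)
    (fun n => ae_of_all _ fun x => ?_) (ae_of_all _ fun x => ?_)
  · rw [Real.norm_eq_abs, abs_le]
    constructor <;> linarith [Real.smoothTransition.nonneg ((n + 1) * (x - a)),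
      Real.smoothTransition.nonneg ((n + 1) * (x - b)),
      Real.smoothTransition.le_one ((n + 1) * (x - a)),
      Real.smoothTransition.le_one ((n + 1) * (x - b))]
  · convert (tendsto_smoothTransition_succ_mul (x - a)).sub
      (tendsto_smoothTransition_succ_mul (x - b)) using 2
    simp only [indicator_apply, mem_Ioc, mem_Ioi, sub_pos, Pi.one_apply]
    split_ifs <;> grind

/-- The mass between two characteristics is conserved. -/
theorem measureReal_Ioc_characteristic_eq (hT : 0 < T)
    (hfin : ∀ t ∈ Icc 0 T, IsFiniteMeasure (m t))
    (hcont : ∀ t ∈ Icc 0 T, Tendsto (fun s => blDist (m s) (m t)) (𝓝[Icc 0 T] t) (𝓝 0))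
    (hM : ∀ t ∈ Icc 0 T, ∀ x, |v t x| ≤ M)
    (hL : ∀ s ∈ Icc 0 T, ∀ x y, |v s x - v s y| ≤ L * |x - y|)
    (hvu : ∀ t ∈ Icc 0 T, TendstoUniformly v (v t) (𝓝[Icc 0 T] t))
    (hw : ∀ f : ℝ × ℝ → ℝ, ContDiff ℝ 1 f → HasCompactSupport f →
      (∫ x, f (x, T) ∂(m T)) - (∫ x, f (x, 0) ∂(m 0)) = ∫ t in (0 : ℝ)..T, ∫ x,
        (fderiv ℝ f (x, t) (0, 1) + v t x * fderiv ℝ f (x, t) (1, 0)) ∂(m t))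
    {X Y : ℝ → ℝ} (hX : IsCharacteristic T v X) (hY : IsCharacteristic T v Y) (h0 : X 0 ≤ Y 0)
    {t : ℝ} (ht : t ∈ Icc 0 T) :
    (m t).real (Ioc (X t) (Y t)) = (m 0).real (Ioc (X 0) (Y 0)) := by
  have h0T : (0 : ℝ) ∈ Icc 0 T := ⟨le_rfl, hT.le⟩
  have hL0 : 0 ≤ L := by simpa using (abs_nonneg _).trans (hL 0 h0T 1 0)
  have hvc : ∀ t ∈ Icc 0 T, Continuous (v t) := fun s hs =>
    (LipschitzWith.of_dist_le_mul (K := L.toNNReal) fun x z => by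
      simpa [Real.dist_eq, hL0] using hL s hs x z).continuous
  let β : ContDiffBump (0 : ℝ) := ⟨T + 1, T + 2, by positivity, by linarith⟩
  have hβ1 : ∀ s ∈ Icc 0 T, (β : ℝ → ℝ) =ᶠ[𝓝 s] fun _ => 1 := fun s hs =>
    β.eventuallyEq_one_of_mem_ball (by
      rw [mem_ball_zero_iff, Real.norm_eq_abs, abs_of_nonneg hs.1]
      exact hs.2.trans_lt (lt_add_one T))
  set f := smoothStrip β X Y with hf
  have hfd : ∀ n, ContDiff ℝ 1 (f n) := contDiff_smoothStrip β.contDiff hX.1 hY.1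
  have hfs : ∀ n, HasCompactSupport (f n) :=
    hasCompactSupport_smoothStrip β.hasCompactSupport hX.1.continuous hY.1.continuous
  obtain ⟨C, hC⟩ := exists_abs_mul_deriv_smoothTransition_le
  obtain ⟨R, hR⟩ := exists_measureReal_univ_le hfin hcont
  have hC0 : 0 ≤ C := (abs_nonneg _).trans (hC 0)
  have hbound : ∀ s ∈ Icc 0 T, ∀ n x, ‖fderiv ℝ (f n) (x, s) (0, 1) +
      v s x * fderiv ℝ (f n) (x, s) (1, 0)‖ ≤ L * C + L * C := fun s hs n x => by
    rw [fderiv_smoothStrip_transport (hβ1 s hs) (hX.2 s hs) (hY.2 s hs)]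
    exact (abs_sub _ _).trans
      (add_le_add (abs_front_le hL0 (hL s hs) hC _ _ _) (abs_front_le hL0 (hL s hs) hC _ _ _))
  have hlim : ∀ s ∈ Icc 0 T, Tendsto (fun n => ∫ x, (fderiv ℝ (f n) (x, s) (0, 1) +
      v s x * fderiv ℝ (f n) (x, s) (1, 0)) ∂(m s)) atTop (𝓝 0) := fun s hs => by
    have := hfin s hs
    rw [show (𝓝 (0 : ℝ)) = 𝓝 (∫ _, (0 : ℝ) ∂(m s)) by rw [integral_zero]]
    refine tendsto_integral_of_dominated_convergence (fun _ => L * C + L * C) (fun n => ?_)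
      (integrable_const _) (fun n => ae_of_all _ (hbound s hs n)) (ae_of_all _ fun x => ?_)
    · have hc : ∀ w, Continuous fun p => fderiv ℝ (f n) p w := fun w =>
        ((hfd n).continuous_fderiv one_ne_zero).clm_apply continuous_const
      have hc0 := hc (0, 1)
      have hc1 := hc (1, 0)
      have hvs := hvc s hs
      exact (by fun_prop : Continuous _).aestronglyMeasurable
    · simp only [hf, fderiv_smoothStrip_transport (hβ1 s hs) (hX.2 s hs) (hY.2 s hs)]
      simpa using (tendsto_front (v s) (X s) x).sub (tendsto_front (v s) (Y s) x)
  have hsub : ∀ s ∈ uIoc 0 t, s ∈ Icc 0 T := fun s hs =>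
    uIcc_subset_Icc h0T ht (uIoc_subset_uIcc hs)
  have hrhs : Tendsto (fun n => ∫ s in (0 : ℝ)..t, ∫ x, (fderiv ℝ (f n) (x, s) (0, 1) +
      v s x * fderiv ℝ (f n) (x, s) (1, 0)) ∂(m s)) atTop (𝓝 (∫ s in (0 : ℝ)..t, (0 : ℝ))) := by
    refine intervalIntegral.tendsto_integral_filter_of_dominated_convergence
      (fun _ => (L * C + L * C) * R) (Eventually.of_forall fun n => ?_)
      (Eventually.of_forall fun n => ae_of_all _ fun s hs => ?_) (by simp)
      (ae_of_all _ fun s hs => hlim s (hsub s hs))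
    · exact ((continuousOn_integral_transport hfin hcont hM hvc hvu (hfd n) (hfs n)).mono
        hsub).aestronglyMeasurable measurableSet_uIoc
    · have := hfin s (hsub s hs)
      refine (norm_integral_le_of_norm_le_const (ae_of_all _ (hbound s (hsub s hs) n))).trans ?_
      gcongr
      exact hR s (hsub s hs)
  have hlhs : ∀ s ∈ Icc 0 T, Tendsto (fun n => ∫ x, f n (x, s) ∂(m s)) atTop
      (𝓝 ((m s).real (Ioc (X s) (Y s)))) := fun s hs => by
    have := hfin s hs
    have h := tendsto_integral_smoothTransition_sub (m s) (hX.le_of_le hY hL h0T hs h0)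
    simpa only [hf, smoothStrip, (hβ1 s hs).eq_of_nhds, one_mul] using h
  have h := tendsto_nhds_unique ((hlhs t ht).sub (hlhs 0 h0T)) (hrhs.congr fun n =>
    (weak_formulation_of_mem_Icc hT hfin hcont hM hvc hvu hw (hfd n) (hfs n) ht).symm)
  rw [intervalIntegral.integral_zero] at h
  linarith

end Conservation

section FlowRepresentation

variable {T L M : ℝ} {m : ℝ → Measure ℝ} {v : ℝ → ℝ → ℝ}

/-- A solution of the transport equation is the image of its initial value under the flow. -/
theorem exists_flow (hT : 0 < T)
    (hfin : ∀ t ∈ Icc 0 T, IsFiniteMeasure (m t))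
    (hcont : ∀ t ∈ Icc 0 T, Tendsto (fun s => blDist (m s) (m t)) (𝓝[Icc 0 T] t) (𝓝 0))
    (hM : ∀ t ∈ Icc 0 T, ∀ x, |v t x| ≤ M)
    (hL : ∀ s ∈ Icc 0 T, ∀ x y, |v s x - v s y| ≤ L * |x - y|)
    (hvu : ∀ t ∈ Icc 0 T, TendstoUniformly v (v t) (𝓝[Icc 0 T] t))
    (hw : ∀ f : ℝ × ℝ → ℝ, ContDiff ℝ 1 f → HasCompactSupport f →
      (∫ x, f (x, T) ∂(m T)) - (∫ x, f (x, 0) ∂(m 0)) = ∫ t in (0 : ℝ)..T, ∫ x,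
        (fderiv ℝ f (x, t) (0, 1) + v t x * fderiv ℝ f (x, t) (1, 0)) ∂(m t)) :
    ∃ Φ : ℝ → ℝ → ℝ, (∀ x, IsCharacteristic T v (Φ x)) ∧ (∀ x, Φ x 0 = x) ∧
      ∀ t ∈ Icc 0 T, Measurable (Φ · t) ∧ m t = (m 0).map (Φ · t) := by
  have h0T : (0 : ℝ) ∈ Icc 0 T := ⟨le_rfl, hT.le⟩
  have hc : ∀ x, ContinuousOn (v · x) (Icc 0 T) := fun x t ht => (hvu t ht).tendsto_at x
  choose Φ hΦ hΦ0 using exists_isCharacteristic hT.le hM hL hc h0T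
  have hmeas : ∀ t ∈ Icc 0 T, Measurable (Φ · t) := fun t ht =>
    Monotone.measurable fun x y hxy =>
      (hΦ x).le_of_le (hΦ y) hL h0T ht (by rwa [hΦ0, hΦ0])
  refine ⟨Φ, hΦ, hΦ0, fun t ht => ⟨hmeas t ht, ?_⟩⟩
  have := hfin t ht
  have := hfin 0 h0T
  refine Measure.ext_of_Ioc _ _ fun a b hab => ?_
  obtain ⟨X, hX, hXa⟩ := exists_isCharacteristic hT.le hM hL hc ht a
  obtain ⟨Y, hY, hYb⟩ := exists_isCharacteristic hT.le hM hL hc ht b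
  have hpre : (Φ · t) ⁻¹' Ioc a b = Ioc (X 0) (Y 0) := by
    ext x
    rw [mem_preimage, mem_Ioc, mem_Ioc, ← hXa, ← hYb, ← not_le, ← not_le,
      (hΦ x).le_iff_le hX hL ht h0T, (hΦ x).le_iff_le hY hL ht h0T, hΦ0]
  have h0 : X 0 ≤ Y 0 := hX.le_of_le hY hL ht h0T (by rw [hXa, hYb]; exact hab.le)
  have h := measureReal_Ioc_characteristic_eq hT hfin hcont hM hL hvu hw hX hY h0 ht
  rw [Measure.map_apply (hmeas t ht) measurableSet_Ioc, hpre, ← hXa, ← hYb]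
  exact (measureReal_eq_measureReal_iff).1 h

end FlowRepresentation

section Uniqueness

variable {T Vmax L : ℝ} {V : Measure ℝ → ℝ → ℝ} {μ₀ : Measure ℝ} {m : ℝ → Measure ℝ}

theorem IsMVSolution.tendsto_blDist (hm : IsMVSolution T V μ₀ m) {t : ℝ} (ht : t ∈ Icc 0 T) :
    Tendsto (fun s => blDist (m s) (m t)) (𝓝[Icc 0 T] t) (𝓝 0) := by
  refine Metric.tendsto_nhdsWithin_nhds.2 fun ε hε => ?_
  obtain ⟨δ, hδ, h⟩ := hm.2.1 t ht ε hε
  refine ⟨δ, hδ, fun {s} hs hst => ?_⟩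
  rw [Real.dist_eq, sub_zero, abs_of_nonneg (blDist_nonneg _ _)]
  exact h s hs hst

theorem IsMVSolution.exists_flow (hT : 0 < T)
    (H1 : ∀ (μ : Measure ℝ), IsFiniteMeasure μ → ∀ x, 0 ≤ V μ x ∧ V μ x ≤ Vmax)
    (H2 : ∀ (μ : Measure ℝ), IsFiniteMeasure μ → ∀ x y, |V μ x - V μ y| ≤ L * |x - y|)
    (H3 : ∀ (μ₁ μ₂ : Measure ℝ), IsFiniteMeasure μ₁ → IsFiniteMeasure μ₂ →
      ∀ x, |V μ₁ x - V μ₂ x| ≤ L * blDist μ₁ μ₂)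
    (hm : IsMVSolution T V μ₀ m) :
    ∃ Φ : ℝ → ℝ → ℝ, (∀ x, IsCharacteristic T (fun s => V (m s)) (Φ x)) ∧ (∀ x, Φ x 0 = x) ∧
      ∀ t ∈ Icc 0 T, Measurable (Φ · t) ∧ m t = μ₀.map (Φ · t) := by
  have hcont : ∀ t ∈ Icc 0 T, Tendsto (fun s => blDist (m s) (m t)) (𝓝[Icc 0 T] t) (𝓝 0) :=
    fun t ht => hm.tendsto_blDist ht
  obtain ⟨hfin, -, rfl, hw⟩ := hm
  refine _root_.exists_flow hT hfin hcont (M := Vmax) (fun t ht x => ?_)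
    (fun s hs => H2 _ (hfin s hs)) (fun t ht => ?_) hw
  · rw [abs_of_nonneg (H1 _ (hfin t ht) x).1]
    exact (H1 _ (hfin t ht) x).2
  · refine Metric.tendstoUniformly_iff.2 fun ε hε => ?_
    have h := (hcont t ht).const_mul L
    rw [mul_zero] at h
    filter_upwards [self_mem_nhdsWithin, h.eventually_lt_const hε] with s hs hlt x
    rw [dist_comm, Real.dist_eq]
    exact (H3 _ _ (hfin s hs) (hfin t ht) x).trans_lt hlt

end Uniqueness

/-- Uniqueness of the measure-valued solution of the nonlinear transport
equation: two solutions with the same initial datum coincide on [0,T]. -/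
theorem mv_solution_unique (T : ℝ) (hT : 0 < T) (Vmax L : ℝ)
    (V : Measure ℝ → ℝ → ℝ)
    (H1 : ∀ (μ : Measure ℝ), IsFiniteMeasure μ → ∀ x, 0 ≤ V μ x ∧ V μ x ≤ Vmax)
    (H2 : ∀ (μ : Measure ℝ), IsFiniteMeasure μ → ∀ x y, |V μ x - V μ y| ≤ L * |x - y|)
    (H3 : ∀ (μ₁ μ₂ : Measure ℝ), IsFiniteMeasure μ₁ → IsFiniteMeasure μ₂ →
      ∀ x, |V μ₁ x - V μ₂ x| ≤ L * blDist μ₁ μ₂)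
    (μ₀ : Measure ℝ) [IsFiniteMeasure μ₀]
    (hmom1 : ∫⁻ x, ENNReal.ofReal |x| ∂μ₀ < ⊤)
    (hmom2 : ∫⁻ x, ENNReal.ofReal (|x| ^ 2) ∂μ₀ < ⊤)
    (m₁ m₂ : ℝ → Measure ℝ)
    (hm₁ : IsMVSolution T V μ₀ m₁) (hm₂ : IsMVSolution T V μ₀ m₂) :
    ∀ t ∈ Set.Icc (0:ℝ) T, m₁ t = m₂ t := by
  obtain ⟨Φ, hΦ, hΦ0, hmΦ⟩ := hm₁.exists_flow hT H1 H2 H3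
  obtain ⟨Ψ, hΨ, hΨ0, hmΨ⟩ := hm₂.exists_flow hT H1 H2 H3
  have hL0 : 0 ≤ L := by simpa using (abs_nonneg _).trans (H2 μ₀ inferInstance 1 0)
  set R := μ₀.real univ with hR
  have hR0 : 0 ≤ R := measureReal_nonneg
  set c := L + 2 * (R + 1) * L + 1 with hc
  have hc0 : 0 ≤ c := by positivity
  have hcontract : ∀ K > 0,
      (∀ t ∈ Icc 0 T, blDist (m₁ t) (m₂ t) ≤ K * Real.exp (c * t)) →
      ∀ x, ∀ t ∈ Icc 0 T, |Φ x t - Ψ x t| ≤ K / (2 * (R + 1)) * Real.exp (c * t) := by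
    intro K hK hD x
    refine (hΦ x).abs_sub_le_exp (hΨ x) (fun s hs => H2 _ (hm₁.1 s hs)) (K := L * K) (by positivity)
      (fun s hs y => ?_) ?_ (by rw [hΦ0, hΨ0])
    · rw [mul_assoc]
      exact (H3 _ _ (hm₁.1 s hs) (hm₂.1 s hs) y).trans (by gcongr; exact hD s hs)
    · have hC : 0 < K / (2 * (R + 1)) := by positivity
      have hK' : K = 2 * (R + 1) * (K / (2 * (R + 1))) := by field_simp
      generalize K / (2 * (R + 1)) = C at hC hK'
      rw [hK', hc]
      linarith
  have hD : ∀ n : ℕ, ∀ t ∈ Icc 0 T,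
      blDist (m₁ t) (m₂ t) ≤ (2 * R + 1) / 2 ^ n * Real.exp (c * t) := by
    intro n
    induction n with
    | zero =>
      intro t ht
      have := hm₁.1 t ht
      have := hm₂.1 t ht
      have h := blDist_le_measure_univ (m₁ t) (m₂ t)
      have h1 : (m₁ t).real univ = R := by
        rw [(hmΦ t ht).2, map_measureReal_apply (hmΦ t ht).1 .univ, preimage_univ]
      have h2 : (m₂ t).real univ = R := by
        rw [(hmΨ t ht).2, map_measureReal_apply (hmΨ t ht).1 .univ, preimage_univ]
      have h3 : 1 ≤ Real.exp (c * t) := Real.one_le_exp (mul_nonneg hc0 ht.1)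
      rw [h1, h2] at h
      rw [pow_zero, div_one]
      nlinarith
    | succ n ih =>
      intro t ht
      have h := blDist_map_le μ₀ (hmΦ t ht).1 (hmΨ t ht).1
        fun x => hcontract _ (by positivity) ih x t ht
      rw [← (hmΦ t ht).2, ← (hmΨ t ht).2, ← hR] at h
      have hRle : R / (R + 1) ≤ 1 := (div_le_one (by positivity)).2 (by linarith)
      calc blDist (m₁ t) (m₂ t) ≤ _ := h
        _ = R / (R + 1) * ((2 * R + 1) / 2 ^ (n + 1) * Real.exp (c * t)) := by
          rw [pow_succ]
          field_simp
        _ ≤ (2 * R + 1) / 2 ^ (n + 1) * Real.exp (c * t) :=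
          mul_le_of_le_one_left (by positivity) hRle
  intro t ht
  rw [(hmΦ t ht).2, (hmΨ t ht).2]
  congr 1
  funext x
  have hlim : Tendsto (fun n : ℕ => (2 * R + 1) / 2 ^ n / (2 * (R + 1)) * Real.exp (c * t)) atTop
      (𝓝 (0 / (2 * (R + 1)) * Real.exp (c * t))) :=
    ((tendsto_const_nhds.div_atTop (tendsto_pow_atTop_atTop_of_one_lt one_lt_two)).div_const
      _).mul_const _
  rw [zero_div, zero_mul] at hlim
  have h := ge_of_tendsto' hlim fun n => hcontract _ (by positivity) (hD n) x t ht
  exact sub_eq_zero.1 (abs_nonpos_iff.1 h)
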